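/- L²_h L∞_z bound for the vertical velocity u^z: for every λ ∈ [0,1) there exists a constant C > 0, depending only on λ, such that for every t ≥ 0, every admissible g, every n ∈ ℕ, and every multi-index α with |α| = n: ‖θ_λ ⟨r⟩ⁿ ∂^α_h u^z‖_{L²_h L^∞_z} ≤ C ⟨t⟩^{1/4} ( ‖θ ⟨r⟩ⁿ ∂^α_h (x∂_x g + y∂_y g)‖_{L²} + ‖θ ⟨r⟩ⁿ ∂^α_h g‖_{L²} ). -/

import Mathlib

open MeasureTheory Filter Set

noncomputable section

/-- `⟨t⟩ = 1 + t` -/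
def angT (t : ℝ) : ℝ := 1 + t

/-- `θ_λ(z) = exp (λ z² / (8⟨t⟩))`; `θ = θ₁`. -/
def thw (t lam z : ℝ) : ℝ := Real.exp (lam * z ^ 2 / (8 * angT t))

/-- `⟨r⟩ = √(x² + y² + 1)` -/
def angR (x y : ℝ) : ℝ := Real.sqrt (x ^ 2 + y ^ 2 + 1)

/-- `Mₙ = (n+1)⁴ / n!` -/
def Mfac (n : ℕ) : ℝ := ((n : ℝ) + 1) ^ 4 / (n.factorial : ℝ)

/-- `∂_x` -/
def pdx (f : ℝ → ℝ → ℝ → ℝ) : ℝ → ℝ → ℝ → ℝ := fun x y z => deriv (fun x' => f x' y z) x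
/-- `∂_y` -/
def pdy (f : ℝ → ℝ → ℝ → ℝ) : ℝ → ℝ → ℝ → ℝ := fun x y z => deriv (fun y' => f x y' z) y
/-- `∂_z` -/
def pdz (f : ℝ → ℝ → ℝ → ℝ) : ℝ → ℝ → ℝ → ℝ := fun x y z => deriv (fun z' => f x y z') z

/-- `∂^α_h = ∂_x^{α₁} ∂_y^{α₂}` for the multi-index `α = (a, b)` -/
def pdh (a b : ℕ) (f : ℝ → ℝ → ℝ → ℝ) : ℝ → ℝ → ℝ → ℝ := pdx^[a] (pdy^[b] f)

/-- `r ∂_r = x ∂_x + y ∂_y` -/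
def rdr (f : ℝ → ℝ → ℝ → ℝ) : ℝ → ℝ → ℝ → ℝ := fun x y z => x * pdx f x y z + y * pdy f x y z

/-- weighted `L²` norm over `ℝ² × (0,∞)` of `θ_λ ⟨r⟩ⁿ f` -/
def L2w (t lam : ℝ) (n : ℕ) (f : ℝ → ℝ → ℝ → ℝ) : ℝ :=
  Real.sqrt (∫ x : ℝ, ∫ y : ℝ, ∫ z in Ioi (0 : ℝ), (thw t lam z * angR x y ^ n * f x y z) ^ 2)

/-- weighted `L²_z` norm at fixed `(x, y)` of `θ_λ ⟨r⟩ⁿ f (x, y, ·)` -/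
def L2z (t lam : ℝ) (n : ℕ) (f : ℝ → ℝ → ℝ → ℝ) (x y : ℝ) : ℝ :=
  Real.sqrt (∫ z in Ioi (0 : ℝ), (thw t lam z * angR x y ^ n * f x y z) ^ 2)

/-- mixed `L^∞_h L²_z` norm of `θ_λ ⟨r⟩ⁿ f` -/
def LIh2z (t lam : ℝ) (n : ℕ) (f : ℝ → ℝ → ℝ → ℝ) : ℝ :=
  Real.sqrt (∫ z in Ioi (0 : ℝ), (⨆ p : ℝ × ℝ, |thw t lam z * angR p.1 p.2 ^ n * f p.1 p.2 z|) ^ 2)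

/-- mixed `L²_h L^∞_z` norm of `θ_λ ⟨r⟩ⁿ f` -/
def L2hIz (t lam : ℝ) (n : ℕ) (f : ℝ → ℝ → ℝ → ℝ) : ℝ :=
  Real.sqrt (∫ x : ℝ, ∫ y : ℝ,
    (⨆ z : Ioi (0 : ℝ), |thw t lam (z : ℝ) * angR x y ^ n * f x y (z : ℝ)|) ^ 2)

/-- the primitive `φ(x,y,z) = exp(−z²/(4⟨t⟩)) ∫₀^z g(x,y,s) exp(s²/(4⟨t⟩)) ds` -/
def phiF (t : ℝ) (g : ℝ → ℝ → ℝ → ℝ) : ℝ → ℝ → ℝ → ℝ := fun x y z =>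
  Real.exp (-(z ^ 2) / (4 * angT t)) * ∫ s in (0 : ℝ)..z, g x y s * Real.exp (s ^ 2 / (4 * angT t))

/-- `u^r = ∂_z φ` -/
def ur (t : ℝ) (g : ℝ → ℝ → ℝ → ℝ) : ℝ → ℝ → ℝ → ℝ := pdz (phiF t g)

/-- `u^z = −(x∂_x + y∂_y)φ − 2φ` -/
def uzv (t : ℝ) (g : ℝ → ℝ → ℝ → ℝ) : ℝ → ℝ → ℝ → ℝ := fun x y z =>
  -(rdr (phiF t g) x y z) - 2 * phiF t g x y z

/-- smoothness together with rapid decay in `z` of all derivatives -/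
def DecaySmooth (g : ℝ → ℝ → ℝ → ℝ) : Prop :=
  ContDiff ℝ (⊤ : ℕ∞) (fun p : ℝ × ℝ × ℝ => g p.1 p.2.1 p.2.2) ∧
  ∀ a b k m : ℕ, ∀ x y : ℝ,
    Tendsto (fun z : ℝ => z ^ m * pdz^[k] (pdh a b g) x y z) atTop (nhds 0)

/-- `θ ⟨r⟩^{|α|} ∂^α_h g ∈ L²(ℝ² × (0,∞))` for every `α` -/
def L2cond (t : ℝ) (g : ℝ → ℝ → ℝ → ℝ) : Prop :=
  ∀ a b : ℕ,
    Integrable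
      (fun p : ℝ × ℝ × ℝ =>
        (thw t 1 p.2.2 * angR p.1 p.2.1 ^ (a + b) * pdh a b g p.1 p.2.1 p.2.2) ^ 2)
      (volume.restrict {p : ℝ × ℝ × ℝ | 0 < p.2.2})

/-- `θ ⟨r⟩^{|α|} ∂^α_h ∂_z g ∈ L²(ℝ² × (0,∞))` for every `α` -/
def L2condZ (t : ℝ) (g : ℝ → ℝ → ℝ → ℝ) : Prop :=
  ∀ a b : ℕ,
    Integrable
      (fun p : ℝ × ℝ × ℝ =>
        (thw t 1 p.2.2 * angR p.1 p.2.1 ^ (a + b) * pdh a b (pdz g) p.1 p.2.1 p.2.2) ^ 2)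
      (volume.restrict {p : ℝ × ℝ × ℝ | 0 < p.2.2})

/-- `X_n(g, τ)` -/
def Xel (t τ : ℝ) (g : ℝ → ℝ → ℝ → ℝ) (n : ℕ) : ℝ :=
  (∑ a ∈ Finset.range (n + 1), L2w t 1 n (pdh a (n - a) g)) * τ ^ n * Mfac n

/-- `D_n(g, τ) = X_n(∂_z g, τ)` -/
def Del (t τ : ℝ) (g : ℝ → ℝ → ℝ → ℝ) (n : ℕ) : ℝ :=
  (∑ a ∈ Finset.range (n + 1), L2w t 1 n (pdh a (n - a) (pdz g))) * τ ^ n * Mfac n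

/-- `Y_n(g, τ)` (with `Y₀ = 0`) -/
def Yel (t τ : ℝ) (g : ℝ → ℝ → ℝ → ℝ) (n : ℕ) : ℝ :=
  (∑ a ∈ Finset.range (n + 1), L2w t 1 n (pdh a (n - a) g)) * τ ^ (n - 1) * (n : ℝ) * Mfac n

/-- `‖g‖_{X_τ}` -/
def Xnrm (t τ : ℝ) (g : ℝ → ℝ → ℝ → ℝ) : ℝ := ∑' n : ℕ, Xel t τ g n
/-- `‖g‖_{D_τ}` -/
def Dnrm (t τ : ℝ) (g : ℝ → ℝ → ℝ → ℝ) : ℝ := ∑' n : ℕ, Del t τ g n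
/-- `‖g‖_{Y_τ}` -/
def Ynrm (t τ : ℝ) (g : ℝ → ℝ → ℝ → ℝ) : ℝ := ∑' n : ℕ, Yel t τ g n

/-- triple integral over `ℝ² × (0,∞)` -/
def trip (F : ℝ → ℝ → ℝ → ℝ) : ℝ := ∫ x : ℝ, ∫ y : ℝ, ∫ z in Ioi (0 : ℝ), F x y z

/-- `I^α_1` -/
def I1 (t : ℝ) (g : ℝ → ℝ → ℝ → ℝ) (a b : ℕ) : ℝ :=
  -trip fun x y z =>
    thw t 2 z * angR x y ^ (2 * (a + b)) *
      pdh a b (fun x' y' z' => ur t g x' y' z' * rdr g x' y' z') x y z * pdh a b g x y z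

/-- `I^α_2` -/
def I2 (t : ℝ) (g : ℝ → ℝ → ℝ → ℝ) (a b : ℕ) : ℝ :=
  -trip fun x y z =>
    thw t 2 z * angR x y ^ (2 * (a + b)) *
      pdh a b (fun x' y' z' => uzv t g x' y' z' * pdz g x' y' z') x y z * pdh a b g x y z

/-- `I^α_3` -/
def I3 (t : ℝ) (g : ℝ → ℝ → ℝ → ℝ) (a b : ℕ) : ℝ :=
  -trip fun x y z =>
    thw t 2 z * angR x y ^ (2 * (a + b)) *
      pdh a b (fun x' y' z' => ur t g x' y' z' ^ 2) x y z * pdh a b g x y z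

/-- `I^α_4` -/
def I4 (t : ℝ) (g : ℝ → ℝ → ℝ → ℝ) (a b : ℕ) : ℝ :=
  (1 / (2 * angT t)) * trip fun x y z =>
    thw t 2 z * angR x y ^ (2 * (a + b)) *
      pdh a b
        (fun x' y' z' =>
          uzv t g x' y' z' * pdz (fun x'' y'' w => w * phiF t g x'' y'' w) x' y' z') x y z *
      pdh a b g x y z

/-- `I^α_5` -/
def I5 (t : ℝ) (g : ℝ → ℝ → ℝ → ℝ) (a b : ℕ) : ℝ :=
  -(1 / angT t) * trip fun x y z =>
    z * thw t 2 z * angR x y ^ (2 * (a + b)) *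
      pdh a b (fun x' y' z' => ur t g x' y' z' * phiF t g x' y' z') x y z * pdh a b g x y z

/-- `I^α_6` -/
def I6 (t : ℝ) (g : ℝ → ℝ → ℝ → ℝ) (a b : ℕ) : ℝ :=
  -(1 / (2 * angT t)) * trip fun x y z =>
    z * thw t 2 z * angR x y ^ (2 * (a + b)) *
      (∫ s in Ioi z, pdh a b (fun x' y' z' => ur t g x' y' z' ^ 2) x y s) * pdh a b g x y z

/-- `I^α_7` -/
def I7 (t : ℝ) (g : ℝ → ℝ → ℝ → ℝ) (a b : ℕ) : ℝ :=
  (1 / angT t) * trip fun x y z =>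
    z * thw t 2 z * angR x y ^ (2 * (a + b)) *
      (∫ s in Ioi z, pdh a b (fun x' y' z' => pdz (ur t g) x' y' z' * uzv t g x' y' z') x y s) *
      pdh a b g x y z

/-- `∑_{|α| = n} |I^α| τⁿ Mₙ / ‖θ ⟨r⟩ⁿ ∂^α_h g‖_{L²}` (with the convention `x / 0 = 0`) -/
def Qterm (t τ : ℝ) (g : ℝ → ℝ → ℝ → ℝ) (I : ℕ → ℕ → ℝ) (n : ℕ) : ℝ :=
  ∑ a ∈ Finset.range (n + 1), |I a (n - a)| * τ ^ n * Mfac n / L2w t 1 n (pdh a (n - a) g)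

/-- `∂_t` -/
def pdt (G : ℝ → ℝ → ℝ → ℝ → ℝ) (t x y z : ℝ) : ℝ := deriv (fun t' => G t' x y z) t

/-- the good-unknown axially symmetric Prandtl equation at the point `(t, x, y, z)` -/
def GoodEq (G : ℝ → ℝ → ℝ → ℝ → ℝ) (t x y z : ℝ) : Prop :=
  pdt G t x y z
      + ur t (G t) x y z * rdr (G t) x y z
      + uzv t (G t) x y z * pdz (G t) x y z
      - pdz (pdz (G t)) x y z
      + G t x y z / angT t
      + ur t (G t) x y z ^ 2
      - 1 / (2 * angT t) * (uzv t (G t) x y z * pdz (fun x' y' w => w * phiF t (G t) x' y' w) x y z)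
      + z / angT t * (ur t (G t) x y z * phiF t (G t) x y z)
      + z / (2 * angT t) * (∫ s in Ioi z, ur t (G t) x y s ^ 2)
      - z / angT t * (∫ s in Ioi z, pdz (ur t (G t)) x y s * uzv t (G t) x y s) = 0

/-- Joint smoothness in the three space variables. -/
def JointSmooth (f : ℝ → ℝ → ℝ → ℝ) : Prop :=
  ContDiff ℝ (⊤ : ℕ∞) (fun p : ℝ × ℝ × ℝ => f p.1 p.2.1 p.2.2)

section Derivatives

variable {f g : ℝ → ℝ → ℝ → ℝ}

theorem JointSmooth.continuous (hf : JointSmooth f) :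
    Continuous (fun p : ℝ × ℝ × ℝ => f p.1 p.2.1 p.2.2) :=
  ContDiff.continuous hf

theorem JointSmooth.hasFDerivAt (hf : JointSmooth f) (p : ℝ × ℝ × ℝ) :
    HasFDerivAt (fun p : ℝ × ℝ × ℝ => f p.1 p.2.1 p.2.2)
      (fderiv ℝ (fun p : ℝ × ℝ × ℝ => f p.1 p.2.1 p.2.2) p) p :=
  (ContDiff.differentiable hf (by simp) p).hasFDerivAt

theorem JointSmooth.hasDerivAt_x_fderiv (hf : JointSmooth f) (x y z : ℝ) :
    HasDerivAt (fun x' => f x' y z)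
      (fderiv ℝ (fun p : ℝ × ℝ × ℝ => f p.1 p.2.1 p.2.2) (x, y, z) (1, 0, 0)) x :=
  HasFDerivAt.comp_hasDerivAt (f := fun s : ℝ => (s, y, z)) x (hf.hasFDerivAt (x, y, z))
    ((hasDerivAt_id x).prodMk ((hasDerivAt_const x y).prodMk (hasDerivAt_const x z)))

theorem JointSmooth.hasDerivAt_y_fderiv (hf : JointSmooth f) (x y z : ℝ) :
    HasDerivAt (fun y' => f x y' z)
      (fderiv ℝ (fun p : ℝ × ℝ × ℝ => f p.1 p.2.1 p.2.2) (x, y, z) (0, 1, 0)) y :=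
  HasFDerivAt.comp_hasDerivAt (f := fun s : ℝ => (x, s, z)) y (hf.hasFDerivAt (x, y, z))
    ((hasDerivAt_const y x).prodMk ((hasDerivAt_id y).prodMk (hasDerivAt_const y z)))

theorem JointSmooth.pdx_eq (hf : JointSmooth f) (x y z : ℝ) :
    pdx f x y z =
      fderiv ℝ (fun p : ℝ × ℝ × ℝ => f p.1 p.2.1 p.2.2) (x, y, z) (1, 0, 0) :=
  (hf.hasDerivAt_x_fderiv x y z).deriv

theorem JointSmooth.pdy_eq (hf : JointSmooth f) (x y z : ℝ) :
    pdy f x y z =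
      fderiv ℝ (fun p : ℝ × ℝ × ℝ => f p.1 p.2.1 p.2.2) (x, y, z) (0, 1, 0) :=
  (hf.hasDerivAt_y_fderiv x y z).deriv

theorem JointSmooth.hasDerivAt_x (hf : JointSmooth f) (x y z : ℝ) :
    HasDerivAt (fun x' => f x' y z) (pdx f x y z) x :=
  hf.pdx_eq x y z ▸ hf.hasDerivAt_x_fderiv x y z

theorem JointSmooth.hasDerivAt_y (hf : JointSmooth f) (x y z : ℝ) :
    HasDerivAt (fun y' => f x y' z) (pdy f x y z) y :=
  hf.pdy_eq x y z ▸ hf.hasDerivAt_y_fderiv x y z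

theorem JointSmooth.pdx (hf : JointSmooth f) : JointSmooth (pdx f) := by
  have h : ContDiff ℝ (⊤ : ℕ∞) (fun p : ℝ × ℝ × ℝ =>
      fderiv ℝ (fun p : ℝ × ℝ × ℝ => f p.1 p.2.1 p.2.2) p (1, 0, 0)) :=
    (ContDiff.fderiv_right hf (by simp)).clm_apply contDiff_const
  unfold JointSmooth
  simpa only [hf.pdx_eq] using h

theorem JointSmooth.pdy (hf : JointSmooth f) : JointSmooth (pdy f) := by
  have h : ContDiff ℝ (⊤ : ℕ∞) (fun p : ℝ × ℝ × ℝ =>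
      fderiv ℝ (fun p : ℝ × ℝ × ℝ => f p.1 p.2.1 p.2.2) p (0, 1, 0)) :=
    (ContDiff.fderiv_right hf (by simp)).clm_apply contDiff_const
  unfold JointSmooth
  simpa only [hf.pdy_eq] using h

theorem JointSmooth.pdy_pdx (hf : JointSmooth f) :
    _root_.pdy (_root_.pdx f) = _root_.pdx (_root_.pdy f) := by
  funext x y z
  rw [hf.pdx.pdy_eq, hf.pdy.pdx_eq]
  simp only [hf.pdx_eq, hf.pdy_eq]
  have hd : DifferentiableAt ℝ
      (fderiv ℝ (fun p : ℝ × ℝ × ℝ => f p.1 p.2.1 p.2.2)) (x, y, z) :=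
    (ContDiff.fderiv_right (m := (⊤ : ℕ∞)) hf (by simp)).differentiable (by simp) _
  have hs : IsSymmSndFDerivAt ℝ (fun p : ℝ × ℝ × ℝ => f p.1 p.2.1 p.2.2) (x, y, z) :=
    (ContDiff.contDiffAt hf).isSymmSndFDerivAt (by
      rw [minSmoothness_of_isRCLikeNormedField]; exact WithTop.coe_le_coe.2 le_top)
  rw [fderiv_clm_apply hd (by fun_prop), fderiv_clm_apply hd (by fun_prop)]
  simpa using hs (0, 1, 0) (1, 0, 0)

theorem JointSmooth.iterate_pdy (hf : JointSmooth f) (b : ℕ) :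
    JointSmooth (_root_.pdy^[b] f) := by
  induction b with
  | zero => exact hf
  | succ b ih => rw [Function.iterate_succ_apply']; exact ih.pdy

theorem JointSmooth.pdh (hf : JointSmooth f) (a b : ℕ) : JointSmooth (pdh a b f) := by
  induction a with
  | zero => exact hf.iterate_pdy b
  | succ a ih =>
    unfold _root_.pdh
    rw [Function.iterate_succ_apply']
    exact ih.pdx

theorem JointSmooth.rdr (hf : JointSmooth f) : JointSmooth (rdr f) :=
  (contDiff_fst.mul hf.pdx).add ((contDiff_fst.comp contDiff_snd).mul hf.pdy)

theorem JointSmooth.lin (hf : JointSmooth f) (hg : JointSmooth g) (c d : ℝ) :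
    JointSmooth (fun x y z => c * f x y z + d * g x y z) :=
  (contDiff_const.mul hf).add (contDiff_const.mul hg)

theorem pdx_lin (hf : JointSmooth f) (hg : JointSmooth g) (c d : ℝ) :
    pdx (fun x y z => c * f x y z + d * g x y z) =
      fun x y z => c * pdx f x y z + d * pdx g x y z := by
  funext x y z
  exact (((hf.hasDerivAt_x x y z).const_mul c).add ((hg.hasDerivAt_x x y z).const_mul d)).deriv

theorem pdy_lin (hf : JointSmooth f) (hg : JointSmooth g) (c d : ℝ) :
    pdy (fun x y z => c * f x y z + d * g x y z) =
      fun x y z => c * pdy f x y z + d * pdy g x y z := by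
  funext x y z
  exact (((hf.hasDerivAt_y x y z).const_mul c).add ((hg.hasDerivAt_y x y z).const_mul d)).deriv

theorem iterate_pdy_lin (hf : JointSmooth f) (hg : JointSmooth g) (c d : ℝ) (b : ℕ) :
    pdy^[b] (fun x y z => c * f x y z + d * g x y z) =
      fun x y z => c * pdy^[b] f x y z + d * pdy^[b] g x y z := by
  induction b with
  | zero => rfl
  | succ b ih =>
    simp only [Function.iterate_succ_apply', ih]
    exact pdy_lin (hf.iterate_pdy b) (hg.iterate_pdy b) c d

theorem pdh_lin (hf : JointSmooth f) (hg : JointSmooth g) (c d : ℝ) (a b : ℕ) :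
    pdh a b (fun x y z => c * f x y z + d * g x y z) =
      fun x y z => c * pdh a b f x y z + d * pdh a b g x y z := by
  induction a with
  | zero => exact iterate_pdy_lin hf hg c d b
  | succ a ih =>
    unfold pdh at ih ⊢
    simp only [Function.iterate_succ_apply', ih]
    exact pdx_lin (hf.pdh a b) (hg.pdh a b) c d

theorem pdx_rdr (hf : JointSmooth f) :
    pdx (rdr f) = fun x y z => 1 * rdr (pdx f) x y z + 1 * pdx f x y z := by
  funext x y z
  have h := ((hasDerivAt_id x).mul (hf.pdx.hasDerivAt_x x y z)).add
    ((hf.pdy.hasDerivAt_x x y z).const_mul y)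
  refine h.deriv.trans ?_
  simp only [rdr, hf.pdy_pdx, id]
  ring

theorem pdy_rdr (hf : JointSmooth f) :
    pdy (rdr f) = fun x y z => 1 * rdr (pdy f) x y z + 1 * pdy f x y z := by
  funext x y z
  have h := ((hf.pdx.hasDerivAt_y x y z).const_mul x).add
    ((hasDerivAt_id y).mul (hf.pdy.hasDerivAt_y x y z))
  refine h.deriv.trans ?_
  simp only [rdr, hf.pdy_pdx, id]
  ring

theorem iterate_pdy_rdr (hf : JointSmooth f) (b : ℕ) :
    pdy^[b] (rdr f) =
      fun x y z => 1 * rdr (pdy^[b] f) x y z + (b : ℝ) * pdy^[b] f x y z := by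
  induction b with
  | zero => simp
  | succ b ih =>
    have hb := hf.iterate_pdy b
    simp only [Function.iterate_succ_apply', ih]
    rw [pdy_lin hb.rdr hb, pdy_rdr hb]
    funext x y z
    push_cast
    ring

theorem pdh_rdr (hf : JointSmooth f) (a b : ℕ) :
    pdh a b (rdr f) =
      fun x y z => 1 * rdr (pdh a b f) x y z + ((a : ℝ) + b) * pdh a b f x y z := by
  induction a with
  | zero => simpa [pdh] using iterate_pdy_rdr hf b
  | succ a ih =>
    have ha := hf.pdh a b
    have hs (u : ℝ → ℝ → ℝ → ℝ) : pdh (a + 1) b u = pdx (pdh a b u) :=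
      Function.iterate_succ_apply' ..
    rw [hs, hs, ih, pdx_lin ha.rdr ha, pdx_rdr ha]
    funext x y z
    push_cast
    ring

theorem pdx_pdh (f : ℝ → ℝ → ℝ → ℝ) (a b : ℕ) : pdx (pdh a b f) = pdh (a + 1) b f :=
  (Function.iterate_succ_apply' ..).symm

theorem pdy_pdh (hf : JointSmooth f) (a b : ℕ) : pdy (pdh a b f) = pdh a (b + 1) f := by
  induction a with
  | zero => exact (Function.iterate_succ_apply' pdy b f).symm
  | succ a ih => rw [← pdx_pdh, ← pdx_pdh, (hf.pdh a b).pdy_pdx, ih]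

end Derivatives

section Primitive

theorem hasDerivAt_intervalIntegral_of_continuous {F F' : ℝ → ℝ → ℝ}
    (hF : Continuous (Function.uncurry F)) (hF' : Continuous (Function.uncurry F'))
    (h : ∀ x s, HasDerivAt (fun x => F x s) (F' x s) x) (a b x : ℝ) :
    HasDerivAt (fun x => ∫ s in a..b, F x s) (∫ s in a..b, F' x s) x := by
  have hc (x : ℝ) : Continuous (F x) := hF.comp (by fun_prop : Continuous fun s => (x, s))
  have hc' (x : ℝ) : Continuous (F' x) := hF'.comp (by fun_prop : Continuous fun s => (x, s))
  obtain ⟨M, hM⟩ := ((isCompact_closedBall x 1).prod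
    (isCompact_uIcc (a := a) (b := b))).exists_bound_of_continuousOn hF'.continuousOn
  refine (intervalIntegral.hasDerivAt_integral_of_dominated_loc_of_deriv_le
    (bound := fun _ => M) (Metric.closedBall_mem_nhds x one_pos)
    (Eventually.of_forall fun x => (hc x).aestronglyMeasurable) ((hc x).intervalIntegrable _ _)
    (hc' x).aestronglyMeasurable (Eventually.of_forall fun s hs x' hx' => ?_)
    intervalIntegrable_const (Eventually.of_forall fun s _ x' _ => h x' s)).2
  exact hM (x', s) ⟨hx', uIoc_subset_uIcc hs⟩

variable {f g : ℝ → ℝ → ℝ → ℝ} {t : ℝ}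

theorem pdx_phiF (hf : JointSmooth f) : pdx (phiF t f) = phiF t (pdx f) := by
  funext x y z
  have c1 := hf.continuous
  have c2 := hf.pdx.continuous
  exact ((hasDerivAt_intervalIntegral_of_continuous
    (F := fun x s => f x y s * Real.exp (s ^ 2 / (4 * angT t)))
    (F' := fun x s => pdx f x y s * Real.exp (s ^ 2 / (4 * angT t)))
    ((c1.comp (by fun_prop : Continuous fun p : ℝ × ℝ => (p.1, y, p.2))).mul (by fun_prop))
    ((c2.comp (by fun_prop : Continuous fun p : ℝ × ℝ => (p.1, y, p.2))).mul (by fun_prop))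
    (fun x s => (hf.hasDerivAt_x x y s).mul_const _) 0 z x).const_mul _).deriv

theorem pdy_phiF (hf : JointSmooth f) : pdy (phiF t f) = phiF t (pdy f) := by
  funext x y z
  have c1 := hf.continuous
  have c2 := hf.pdy.continuous
  exact ((hasDerivAt_intervalIntegral_of_continuous
    (F := fun y s => f x y s * Real.exp (s ^ 2 / (4 * angT t)))
    (F' := fun y s => pdy f x y s * Real.exp (s ^ 2 / (4 * angT t)))
    ((c1.comp (by fun_prop : Continuous fun p : ℝ × ℝ => (x, p.1, p.2))).mul (by fun_prop))
    ((c2.comp (by fun_prop : Continuous fun p : ℝ × ℝ => (x, p.1, p.2))).mul (by fun_prop))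
    (fun y s => (hf.hasDerivAt_y x y s).mul_const _) 0 z y).const_mul _).deriv

theorem pdh_phiF (hf : JointSmooth f) (a b : ℕ) : pdh a b (phiF t f) = phiF t (pdh a b f) := by
  have hy : pdy^[b] (phiF t f) = phiF t (pdy^[b] f) := by
    induction b with
    | zero => rfl
    | succ b ih =>
      simp only [Function.iterate_succ_apply', ih]
      exact pdy_phiF (hf.iterate_pdy b)
  induction a with
  | zero => exact hy
  | succ a ih => rw [← pdx_pdh, ← pdx_pdh, ih, pdx_phiF (hf.pdh a b)]

theorem JointSmooth.continuous_z (hf : JointSmooth f) (x y : ℝ) : Continuous (f x y) :=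
  hf.continuous.comp (by fun_prop : Continuous fun s : ℝ => (x, y, s))

theorem phiF_lin_apply {h : ℝ → ℝ → ℝ → ℝ} (hf : JointSmooth f) (hg : JointSmooth g)
    {x y c d : ℝ} (hh : ∀ s, h x y s = c * f x y s + d * g x y s) (z : ℝ) :
    phiF t h x y z = c * phiF t f x y z + d * phiF t g x y z := by
  have cf := hf.continuous_z x y
  have cg := hg.continuous_z x y
  have e : ∫ s in (0 : ℝ)..z, h x y s * Real.exp (s ^ 2 / (4 * angT t)) =
      c * (∫ s in (0 : ℝ)..z, f x y s * Real.exp (s ^ 2 / (4 * angT t))) +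
      d * ∫ s in (0 : ℝ)..z, g x y s * Real.exp (s ^ 2 / (4 * angT t)) := by
    rw [← intervalIntegral.integral_const_mul, ← intervalIntegral.integral_const_mul,
      ← intervalIntegral.integral_add
        (Continuous.intervalIntegrable (by fun_prop) _ _)
        (Continuous.intervalIntegrable (by fun_prop) _ _)]
    refine intervalIntegral.integral_congr fun s _ => ?_
    simp only [hh]
    ring
  unfold phiF
  rw [e]
  ring

theorem uzv_eq_phiF (hf : JointSmooth f) :
    uzv t f = phiF t (fun x y z => -1 * rdr f x y z + -2 * f x y z) := by
  funext x y z
  rw [phiF_lin_apply hf.rdr hf (fun _ => rfl), uzv, rdr, pdx_phiF hf, pdy_phiF hf,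
    phiF_lin_apply hf.pdx hf.pdy (h := rdr f) (fun _ => rfl)]
  ring

theorem pdh_uzv (hf : JointSmooth f) (a b : ℕ) :
    pdh a b (uzv t f) =
      phiF t (fun x y z => -1 * pdh a b (rdr f) x y z + -2 * pdh a b f x y z) := by
  rw [uzv_eq_phiF hf, pdh_phiF (hf.rdr.lin hf _ _), pdh_lin hf.rdr hf]

end Primitive

section WeightedBounds

theorem integral_mul_sq_le {α : Type*} [MeasurableSpace α] {μ : Measure α} {f g : α → ℝ}
    (hf : MemLp f 2 μ) (hg : MemLp g 2 μ) (hf0 : 0 ≤ f) (hg0 : 0 ≤ g) :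
    (∫ a, f a * g a ∂μ) ^ 2 ≤ (∫ a, f a ^ 2 ∂μ) * ∫ a, g a ^ 2 ∂μ := by
  have h := integral_mul_le_Lp_mul_Lq_of_nonneg (μ := μ) (p := 2) (q := 2) .two_two
    (Eventually.of_forall hf0) (Eventually.of_forall hg0) (by simpa using hf) (by simpa using hg)
  simp only [Real.rpow_two, ← Real.sqrt_eq_rpow] at h
  have h0 : 0 ≤ ∫ a, f a * g a ∂μ := integral_nonneg fun a => mul_nonneg (hf0 a) (hg0 a)
  calc (∫ a, f a * g a ∂μ) ^ 2 ≤ _ := pow_le_pow_left₀ h0 h 2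
    _ = _ := by
      rw [mul_pow, Real.sq_sqrt (integral_nonneg fun _ => sq_nonneg _),
        Real.sq_sqrt (integral_nonneg fun _ => sq_nonneg _)]

theorem angT_pos {t : ℝ} (ht : 0 ≤ t) : 0 < angT t := by unfold angT; linarith

theorem thw_mul_exp_le {t lam s z : ℝ} (ht : 0 ≤ t) (hlam : lam < 1) (hs : 0 ≤ s) (hsz : s ≤ z) :
    thw t lam z * Real.exp (-(z ^ 2) / (4 * angT t)) * Real.exp (s ^ 2 / (4 * angT t)) ≤
      thw t 1 s * Real.exp (-((1 - lam) / (8 * angT t)) * s ^ 2) := by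
  have hc := angT_pos ht
  unfold thw
  rw [← Real.exp_add, ← Real.exp_add, ← Real.exp_add, Real.exp_le_exp]
  have hsq : s ^ 2 ≤ z ^ 2 := pow_le_pow_left₀ hs hsz 2
  have h : 0 ≤ (2 - lam) * (z ^ 2 - s ^ 2) / (8 * angT t) :=
    div_nonneg (mul_nonneg (by linarith) (by linarith)) (by linarith)
  rw [← sub_nonneg]
  convert h using 1
  field_simp
  ring

theorem integral_exp_sq_weight {t lam : ℝ} (ht : 0 ≤ t) (hlam : lam < 1) :
    ∫ s in Ioi (0 : ℝ), Real.exp (-((1 - lam) / (8 * angT t)) * s ^ 2) ^ 2 =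
      √(Real.pi / (1 - lam)) * √(angT t) := by
  have hc := angT_pos ht
  have hl : 0 < 1 - lam := by linarith
  have e (s : ℝ) : Real.exp (-((1 - lam) / (8 * angT t)) * s ^ 2) ^ 2 =
      Real.exp (-((1 - lam) / (4 * angT t)) * s ^ 2) := by
    rw [← Real.exp_nat_mul]
    congr 1
    push_cast
    ring
  simp only [e]
  rw [integral_gaussian_Ioi, ← Real.sqrt_mul (by positivity),
    show Real.pi / ((1 - lam) / (4 * angT t)) = 2 ^ 2 * (Real.pi / (1 - lam) * angT t) by
      field_simp; ring,
    Real.sqrt_mul (by positivity), Real.sqrt_sq (by norm_num)]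
  ring

theorem continuous_thw (t lam : ℝ) : Continuous (thw t lam) := by
  unfold thw
  fun_prop

theorem sq_weighted_phiF_le {t lam : ℝ} (ht : 0 ≤ t) (hlam : lam < 1) (n : ℕ)
    {f : ℝ → ℝ → ℝ → ℝ} {x y : ℝ} (hf : Continuous (f x y))
    (hint : IntegrableOn (fun s => (thw t 1 s * angR x y ^ n * f x y s) ^ 2) (Ioi 0))
    {z : ℝ} (hz : 0 < z) :
    (thw t lam z * angR x y ^ n * phiF t f x y z) ^ 2 ≤
      √(Real.pi / (1 - lam)) * √(angT t) *
        ∫ s in Ioi (0 : ℝ), (thw t 1 s * angR x y ^ n * f x y s) ^ 2 := by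
  have hc := angT_pos ht
  have cw := continuous_thw t 1
  have hR : 0 ≤ angR x y ^ n := pow_nonneg (Real.sqrt_nonneg _) n
  set F : ℝ → ℝ := fun s => |thw t 1 s * angR x y ^ n * f x y s|
  set G : ℝ → ℝ := fun s => Real.exp (-((1 - lam) / (8 * angT t)) * s ^ 2)
  have cF : Continuous F := by fun_prop
  have cG : Continuous G := by fun_prop
  have cFG : Continuous fun s => F s * G s := cF.mul cG
  have hF0 : 0 ≤ F := fun s => abs_nonneg _
  have hG0 : 0 ≤ G := fun s => (Real.exp_pos _).le
  have hF2 (s : ℝ) : F s ^ 2 = (thw t 1 s * angR x y ^ n * f x y s) ^ 2 := sq_abs _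
  have mF : MemLp F 2 (volume.restrict (Ioi 0)) :=
    (memLp_two_iff_integrable_sq cF.aestronglyMeasurable).2
      (by simpa only [hF2, IntegrableOn] using hint)
  have mG : MemLp G 2 (volume.restrict (Ioi 0)) := by
    refine (memLp_two_iff_integrable_sq cG.aestronglyMeasurable).2 ?_
    refine Integrable.of_integral_ne_zero ?_
    rw [integral_exp_sq_weight ht hlam]
    have : 0 < 1 - lam := by linarith
    positivity
  have hFG : IntegrableOn (fun s => F s * G s) (Ioi 0) := mF.integrable_mul mG
  have key : |thw t lam z * angR x y ^ n * phiF t f x y z| ≤ ∫ s in Ioi (0 : ℝ), F s * G s := by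
    have e : thw t lam z * angR x y ^ n * phiF t f x y z =
        ∫ s in (0 : ℝ)..z, thw t lam z * Real.exp (-(z ^ 2) / (4 * angT t)) *
          Real.exp (s ^ 2 / (4 * angT t)) * (angR x y ^ n * f x y s) := by
      unfold phiF
      rw [← mul_assoc, ← intervalIntegral.integral_const_mul]
      refine intervalIntegral.integral_congr fun s _ => ?_
      ring
    rw [e, ← Real.norm_eq_abs]
    calc _ ≤ ∫ s in (0 : ℝ)..z, F s * G s := by
          refine intervalIntegral.norm_integral_le_of_norm_le hz.le
            (Eventually.of_forall fun s hs => ?_) (cFG.intervalIntegrable _ _)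
          have hle := thw_mul_exp_le ht hlam hs.1.le hs.2
          have hpos (l v : ℝ) : 0 ≤ thw t l v := (Real.exp_pos _).le
          rw [Real.norm_eq_abs, abs_mul, abs_of_nonneg
            (mul_nonneg (mul_nonneg (hpos _ _) (Real.exp_pos _).le) (Real.exp_pos _).le)]
          refine (mul_le_mul_of_nonneg_right hle (abs_nonneg _)).trans_eq ?_
          simp only [F, G]
          rw [mul_assoc (thw t 1 s) (angR x y ^ n), abs_mul (thw t 1 s), abs_of_nonneg (hpos 1 s)]
          ring
      _ = ∫ s in Ioc (0 : ℝ) z, F s * G s := intervalIntegral.integral_of_le hz.le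
      _ ≤ _ := setIntegral_mono_set hFG
          (Eventually.of_forall fun s => mul_nonneg (hF0 s) (hG0 s))
          (Ioc_subset_Ioi_self.eventuallyLE)
  calc _ = |thw t lam z * angR x y ^ n * phiF t f x y z| ^ 2 := (sq_abs _).symm
    _ ≤ (∫ s in Ioi (0 : ℝ), F s * G s) ^ 2 := pow_le_pow_left₀ (abs_nonneg _) key 2
    _ ≤ _ := integral_mul_sq_le mF mG hF0 hG0
    _ = _ := by
      rw [integral_exp_sq_weight ht hlam, mul_comm]
      simp only [hF2]

end WeightedBounds

section HalfSpace

/-- Lebesgue measure on `ℝ² × (0,∞)`. -/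
def halfSpaceMeasure : Measure (ℝ × ℝ × ℝ) :=
  volume.restrict {p : ℝ × ℝ × ℝ | 0 < p.2.2}

theorem halfSpaceMeasure_eq :
    halfSpaceMeasure =
      (volume : Measure ℝ).prod ((volume : Measure ℝ).prod (volume.restrict (Ioi (0 : ℝ)))) := by
  have hs : {p : ℝ × ℝ × ℝ | 0 < p.2.2} = univ ×ˢ (univ ×ˢ Ioi (0 : ℝ)) := by
    ext p
    simp
  rw [halfSpaceMeasure, hs, Measure.volume_eq_prod, ← Measure.prod_restrict,
    Measure.volume_eq_prod, ← Measure.prod_restrict, Measure.restrict_univ]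

theorem integrable_halfSpace_assoc {F : ℝ × ℝ × ℝ → ℝ} (hF : Integrable F halfSpaceMeasure) :
    Integrable (fun q : (ℝ × ℝ) × ℝ => F (q.1.1, q.1.2, q.2))
      (((volume : Measure ℝ).prod (volume : Measure ℝ)).prod (volume.restrict (Ioi (0 : ℝ)))) := by
  rw [halfSpaceMeasure_eq] at hF
  exact (MeasureTheory.measurePreserving_prodAssoc (volume : Measure ℝ) (volume : Measure ℝ)
    (volume.restrict (Ioi (0 : ℝ)))).integrable_comp_of_integrable hF

/-- Square integrability of `θ_λ ⟨r⟩ⁿ f` on `ℝ² × (0,∞)`. -/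
def WeightedSqIntegrable (t lam : ℝ) (n : ℕ) (f : ℝ → ℝ → ℝ → ℝ) : Prop :=
  Integrable (fun p : ℝ × ℝ × ℝ =>
    (thw t lam p.2.2 * angR p.1 p.2.1 ^ n * f p.1 p.2.1 p.2.2) ^ 2) halfSpaceMeasure

theorem continuous_angR : Continuous (fun p : ℝ × ℝ => angR p.1 p.2) := by
  unfold angR
  fun_prop

theorem JointSmooth.continuous_weighted {f : ℝ → ℝ → ℝ → ℝ} (hf : JointSmooth f)
    (t lam : ℝ) (n : ℕ) :
    Continuous (fun p : ℝ × ℝ × ℝ =>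
      (thw t lam p.2.2 * angR p.1 p.2.1 ^ n * f p.1 p.2.1 p.2.2) ^ 2) := by
  have h1 : Continuous fun p : ℝ × ℝ × ℝ => thw t lam p.2.2 :=
    (continuous_thw t lam).comp (by fun_prop)
  have h2 : Continuous fun p : ℝ × ℝ × ℝ => angR p.1 p.2.1 :=
    continuous_angR.comp (by fun_prop : Continuous fun p : ℝ × ℝ × ℝ => (p.1, p.2.1))
  exact ((h1.mul (h2.pow n)).mul hf.continuous).pow 2

theorem WeightedSqIntegrable.lin {t lam : ℝ} {n : ℕ} {f g : ℝ → ℝ → ℝ → ℝ}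
    (hf : WeightedSqIntegrable t lam n f) (hg : WeightedSqIntegrable t lam n g)
    (sf : JointSmooth f) (sg : JointSmooth g) (c d : ℝ) :
    WeightedSqIntegrable t lam n (fun x y z => c * f x y z + d * g x y z) := by
  refine Integrable.mono' ((hf.const_mul (2 * c ^ 2)).add (hg.const_mul (2 * d ^ 2)))
    ((sf.lin sg c d).continuous_weighted t lam n).aestronglyMeasurable
    (Eventually.of_forall fun p => ?_)
  rw [Real.norm_of_nonneg (sq_nonneg _)]
  simp only [Pi.add_apply]
  set w := thw t lam p.2.2 * angR p.1 p.2.1 ^ n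
  nlinarith [sq_nonneg (w * (c * f p.1 p.2.1 p.2.2) - w * (d * g p.1 p.2.1 p.2.2))]

theorem weightedSqIntegrable_rdr {t lam : ℝ} {n : ℕ} {f : ℝ → ℝ → ℝ → ℝ} (sf : JointSmooth f)
    (hx : WeightedSqIntegrable t lam (n + 1) (pdx f))
    (hy : WeightedSqIntegrable t lam (n + 1) (pdy f)) :
    WeightedSqIntegrable t lam n (rdr f) := by
  refine Integrable.mono' (hx.add hy) (sf.rdr.continuous_weighted t lam n).aestronglyMeasurable
    (Eventually.of_forall fun p => ?_)
  rw [Real.norm_of_nonneg (sq_nonneg _)]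
  simp only [Pi.add_apply, rdr]
  have hR : angR p.1 p.2.1 ^ 2 = p.1 ^ 2 + p.2.1 ^ 2 + 1 := Real.sq_sqrt (by positivity)
  rw [mul_pow, mul_pow (thw t lam p.2.2 * _) (pdx f _ _ _),
    mul_pow (thw t lam p.2.2 * _) (pdy f _ _ _), ← mul_add,
    show (thw t lam p.2.2 * angR p.1 p.2.1 ^ (n + 1)) ^ 2 =
      (thw t lam p.2.2 * angR p.1 p.2.1 ^ n) ^ 2 * angR p.1 p.2.1 ^ 2 by ring, hR, mul_assoc]
  refine mul_le_mul_of_nonneg_left ?_ (sq_nonneg _)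
  set u := pdx f p.1 p.2.1 p.2.2
  set v := pdy f p.1 p.2.1 p.2.2
  nlinarith [sq_nonneg (p.1 * v - p.2.1 * u), sq_nonneg u, sq_nonneg v]

theorem L2cond.weightedSqIntegrable_pdh_rdr {t : ℝ} {g : ℝ → ℝ → ℝ → ℝ} (h : L2cond t g)
    (sg : JointSmooth g) (a b : ℕ) : WeightedSqIntegrable t 1 (a + b) (pdh a b (rdr g)) := by
  have hg := sg.pdh a b
  rw [pdh_rdr sg]
  refine WeightedSqIntegrable.lin (weightedSqIntegrable_rdr hg ?_ ?_) (h a b) hg.rdr hg _ _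
  · rw [pdx_pdh, show a + b + 1 = a + 1 + b by ring]
    exact h (a + 1) b
  · rw [pdy_pdh sg]
    exact h a (b + 1)

theorem WeightedSqIntegrable.ae_integrableOn {t lam : ℝ} {n : ℕ} {f : ℝ → ℝ → ℝ → ℝ}
    (hf : WeightedSqIntegrable t lam n f) :
    ∀ᵐ q : ℝ × ℝ ∂((volume : Measure ℝ).prod (volume : Measure ℝ)),
      IntegrableOn (fun z => (thw t lam z * angR q.1 q.2 ^ n * f q.1 q.2 z) ^ 2) (Ioi 0) :=
  (integrable_halfSpace_assoc hf).prod_right_ae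

theorem WeightedSqIntegrable.integrable_integral {t lam : ℝ} {n : ℕ} {f : ℝ → ℝ → ℝ → ℝ}
    (hf : WeightedSqIntegrable t lam n f) :
    Integrable (fun q : ℝ × ℝ =>
        ∫ z in Ioi (0 : ℝ), (thw t lam z * angR q.1 q.2 ^ n * f q.1 q.2 z) ^ 2)
      ((volume : Measure ℝ).prod (volume : Measure ℝ)) :=
  (integrable_halfSpace_assoc hf).integral_prod_left

/-- No measurability of `S` is required. -/
theorem integral_integral_mono_of_nonneg {S : ℝ → ℝ → ℝ} {B : ℝ × ℝ → ℝ} (hS : ∀ x y, 0 ≤ S x y)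
    (hB : Integrable B ((volume : Measure ℝ).prod (volume : Measure ℝ)))
    (h : ∀ᵐ q ∂((volume : Measure ℝ).prod (volume : Measure ℝ)), S q.1 q.2 ≤ B q) :
    ∫ x, ∫ y, S x y ≤ ∫ x, ∫ y, B (x, y) := by
  refine integral_mono_of_nonneg (Eventually.of_forall fun x => integral_nonneg (hS x))
    hB.integral_prod_left ?_
  filter_upwards [hB.prod_right_ae, Measure.ae_ae_of_ae_prod h] with x hx hx'
  exact integral_mono_of_nonneg (Eventually.of_forall (hS x)) hx hx'

theorem sq_L2w (t lam : ℝ) (n : ℕ) (f : ℝ → ℝ → ℝ → ℝ) :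
    L2w t lam n f ^ 2 =
      ∫ x : ℝ, ∫ y : ℝ, ∫ z in Ioi (0 : ℝ), (thw t lam z * angR x y ^ n * f x y z) ^ 2 :=
  Real.sq_sqrt (integral_nonneg fun _ => integral_nonneg fun _ => integral_nonneg fun _ =>
    sq_nonneg _)

theorem sq_weighted_phiF_lin_le {t lam : ℝ} (ht : 0 ≤ t) (hlam : lam < 1) (n : ℕ)
    {f g : ℝ → ℝ → ℝ → ℝ} {x y : ℝ} (sf : JointSmooth f) (sg : JointSmooth g)
    (hf : IntegrableOn (fun s => (thw t 1 s * angR x y ^ n * f x y s) ^ 2) (Ioi 0))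
    (hg : IntegrableOn (fun s => (thw t 1 s * angR x y ^ n * g x y s) ^ 2) (Ioi 0))
    (c d : ℝ) {z : ℝ} (hz : 0 < z) :
    (thw t lam z * angR x y ^ n * phiF t (fun x y z => c * f x y z + d * g x y z) x y z) ^ 2 ≤
      2 * (√(Real.pi / (1 - lam)) * √(angT t)) *
        (c ^ 2 * (∫ s in Ioi (0 : ℝ), (thw t 1 s * angR x y ^ n * f x y s) ^ 2) +
          d ^ 2 * ∫ s in Ioi (0 : ℝ), (thw t 1 s * angR x y ^ n * g x y s) ^ 2) := by
  rw [phiF_lin_apply sf sg (fun _ => rfl)]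
  have h1 := mul_le_mul_of_nonneg_left
    (sq_weighted_phiF_le ht hlam n (sf.continuous_z x y) hf hz) (sq_nonneg c)
  have h2 := mul_le_mul_of_nonneg_left
    (sq_weighted_phiF_le ht hlam n (sg.continuous_z x y) hg hz) (sq_nonneg d)
  set w := thw t lam z * angR x y ^ n
  nlinarith [sq_nonneg (w * (c * phiF t f x y z) - w * (d * phiF t g x y z))]

theorem sq_L2hIz_phiF_lin_le {t lam : ℝ} (ht : 0 ≤ t) (hlam : lam < 1) (n : ℕ)
    {f g : ℝ → ℝ → ℝ → ℝ} (sf : JointSmooth f) (sg : JointSmooth g)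
    (hf : WeightedSqIntegrable t 1 n f) (hg : WeightedSqIntegrable t 1 n g) (c d : ℝ) :
    L2hIz t lam n (phiF t (fun x y z => c * f x y z + d * g x y z)) ^ 2 ≤
      2 * (√(Real.pi / (1 - lam)) * √(angT t)) *
        (c ^ 2 * L2w t 1 n f ^ 2 + d ^ 2 * L2w t 1 n g ^ 2) := by
  have iA := hf.integrable_integral
  have iB := hg.integrable_integral
  rw [L2hIz, Real.sq_sqrt (integral_nonneg fun _ => integral_nonneg fun _ => sq_nonneg _),
    sq_L2w, sq_L2w]
  refine (integral_integral_mono_of_nonneg (fun _ _ => sq_nonneg _)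
    (((iA.const_mul (c ^ 2)).add (iB.const_mul (d ^ 2))).const_mul
      (2 * (√(Real.pi / (1 - lam)) * √(angT t)))) ?_).trans_eq ?_
  · filter_upwards [hf.ae_integrableOn, hg.ae_integrableOn] with q h1 h2
    have hb (z : ℝ) (hz : 0 < z) := sq_weighted_phiF_lin_le ht hlam n sf sg h1 h2 c d hz
    have h0 := (sq_nonneg _).trans (hb 1 one_pos)
    refine (Real.le_sqrt (Real.iSup_nonneg fun _ => abs_nonneg _) h0).1 ?_
    exact Real.iSup_le (fun z => Real.abs_le_sqrt (hb z z.2)) (Real.sqrt_nonneg _)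
  · simp only [Pi.add_apply, integral_const_mul]
    congr 1
    rw [integral_integral_add (iA.const_mul (c ^ 2)) (iB.const_mul (d ^ 2))]
    simp only [integral_const_mul]

end HalfSpace

/-- `L²_h L^∞_z` bound for the vertical velocity `u^z`. -/
theorem L2hLinfz_bound_uz :
    ∀ lam : ℝ, 0 ≤ lam → lam < 1 → ∃ C : ℝ, 0 < C ∧
      ∀ t : ℝ, 0 ≤ t → ∀ g : ℝ → ℝ → ℝ → ℝ, DecaySmooth g → L2cond t g →
        ∀ n a b : ℕ, a + b = n →
          L2hIz t lam n (pdh a b (uzv t g)) ≤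
            C * angT t ^ ((1 : ℝ) / 4) *
              (L2w t 1 n (pdh a b (rdr g)) + L2w t 1 n (pdh a b g)) := by
  intro lam _ hlam
  have hl : 0 < 1 - lam := by linarith
  refine ⟨√(8 * √(Real.pi / (1 - lam))), by positivity, ?_⟩
  rintro t ht g ⟨sg, -⟩ hg n a b rfl
  have sg : JointSmooth g := sg
  have hc := angT_pos ht
  have hX : 0 ≤ L2w t 1 (a + b) (pdh a b (rdr g)) := Real.sqrt_nonneg _
  have hY : 0 ≤ L2w t 1 (a + b) (pdh a b g) := Real.sqrt_nonneg _
  have hq : (angT t ^ ((1 : ℝ) / 4)) ^ 2 = √(angT t) := by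
    rw [← Real.rpow_natCast, ← Real.rpow_mul hc.le, Real.sqrt_eq_rpow]
    norm_num
  rw [pdh_uzv sg]
  refine le_of_sq_le_sq ?_ (by positivity)
  refine (sq_L2hIz_phiF_lin_le ht hlam (a + b) (sg.rdr.pdh a b) (sg.pdh a b)
    (hg.weightedSqIntegrable_pdh_rdr sg a b) (hg a b) (-1) (-2)).trans ?_
  rw [mul_pow, mul_pow, hq, Real.sq_sqrt (by positivity)]
  set X := L2w t 1 (a + b) (pdh a b (rdr g))
  set Y := L2w t 1 (a + b) (pdh a b g)
  have hK : 0 ≤ √(Real.pi / (1 - lam)) * √(angT t) := by positivity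
  nlinarith [mul_nonneg hK (sq_nonneg X), mul_nonneg hK (mul_nonneg hX hY)]
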